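/- arXiv:2410.06797 — 4 statements merged into one kernel-verified Lean document; each statement's English description precedes it below -/
import Mathlib

section
/- Let P be a partition of the players, φ ∈ Φ^P a Nash equilibrium for P, and β ≥ 0 the per-communication cost. Then the P-NE pair (P,φ) is stable if and only if the configuration (P,φ,ψ_f) with the fair payoff vector ψ_f is stable. -/
open Finset

namespace CG

variable {N M : ℕ}

/-- Number of players choosing link `a` under profile `φ`. -/
def gamma (φ : Fin N → Fin M) (a : Fin M) : ℕ :=
  (Finset.univ.filter fun i => φ i = a).card

/-- Utility of coalition `C` under profile `φ` at per-communication cost `β`. -/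
noncomputable def util (μ : Fin M → ℕ → ℝ) (β : ℝ) (C : Finset (Fin N))
    (φ : Fin N → Fin M) : ℝ :=
  (∑ i ∈ C, μ (φ i) (gamma φ (φ i))) - ((C.card : ℝ) - 1) * β

/-- `P` is a partition of the player set into (nonempty, pairwise disjoint) coalitions. -/
def IsPartition (P : Finset (Finset (Fin N))) : Prop :=
  (∀ C ∈ P, C.Nonempty) ∧
  (∀ C ∈ P, ∀ C' ∈ P, C ≠ C' → Disjoint C C') ∧
  (∀ i : Fin N, ∃ C ∈ P, i ∈ C)

/-- `φ` is a Nash equilibrium for partition `P`: no coalition of `P` can strictly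
improve its utility by unilaterally changing the strategies of its own members. -/
def IsNE (μ : Fin M → ℕ → ℝ) (β : ℝ) (P : Finset (Finset (Fin N)))
    (φ : Fin N → Fin M) : Prop :=
  ∀ C ∈ P, ∀ φ' : Fin N → Fin M, (∀ i ∉ C, φ' i = φ i) →
    util μ β C φ' ≤ util μ β C φ

/-- Pessimal anticipated worth of a coalition `C`. -/
noncomputable def pess (μ : Fin M → ℕ → ℝ) (β : ℝ) (C : Finset (Fin N)) : ℝ :=
  sInf {x : ℝ | ∃ P' : Finset (Finset (Fin N)), ∃ φ' : Fin N → Fin M,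
    IsPartition P' ∧ C ∈ P' ∧ IsNE μ β P' φ' ∧ x = util μ β C φ'}

/-- `ψ` is a payoff vector consistent with `(P, φ)`. -/
def Consistent (μ : Fin M → ℕ → ℝ) (β : ℝ) (P : Finset (Finset (Fin N)))
    (φ : Fin N → Fin M) (ψ : Fin N → ℝ) : Prop :=
  (∀ j, 0 ≤ ψ j) ∧ ∀ C ∈ P, ∑ j ∈ C, ψ j = util μ β C φ

/-- Coalition `C ∉ P` blocks the configuration with payoff vector `ψ`. -/
def Blocks (μ : Fin M → ℕ → ℝ) (β : ℝ) (P : Finset (Finset (Fin N)))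
    (ψ : Fin N → ℝ) (C : Finset (Fin N)) : Prop :=
  C.Nonempty ∧ C ∉ P ∧ ∑ j ∈ C, ψ j < pess μ β C

/-- The configuration `(P, φ, ψ)` is stable. -/
def ConfigStable (μ : Fin M → ℕ → ℝ) (β : ℝ) (P : Finset (Finset (Fin N)))
    (φ : Fin N → Fin M) (ψ : Fin N → ℝ) : Prop :=
  IsPartition P ∧ IsNE μ β P φ ∧ Consistent μ β P φ ψ ∧
    ∀ C : Finset (Fin N), ¬ Blocks μ β P ψ C

/-- The P-NE pair `(P, φ)` is stable. -/
def PairStable (μ : Fin M → ℕ → ℝ) (β : ℝ) (P : Finset (Finset (Fin N)))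
    (φ : Fin N → Fin M) : Prop :=
  ∃ ψ : Fin N → ℝ, ConfigStable μ β P φ ψ

/-- The partition `P` is stable. -/
def PartStable (μ : Fin M → ℕ → ℝ) (β : ℝ) (P : Finset (Finset (Fin N))) : Prop :=
  ∃ φ : Fin N → Fin M, PairStable μ β P φ

/-- The ALC partition, in which every player is a singleton coalition. -/
def ALC (N : ℕ) : Finset (Finset (Fin N)) :=
  Finset.univ.image fun i => ({i} : Finset (Fin N))

/-- `D_C^P = Σ_i q_i(C)/l_i − 1`. -/
noncomputable def Dcoef (P : Finset (Finset (Fin N))) (C : Finset (Fin N)) : ℝ :=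
  (∑ Ci ∈ P, ((Ci ∩ C).card : ℝ) / (Ci.card : ℝ)) - 1

/-- `Γ_C^P(φ) = Σ_i (q_i(C)/l_i) ν_{C_i}^{0,P}(φ) − ν̲_C^0`. -/
noncomputable def Gam (μ : Fin M → ℕ → ℝ) (P : Finset (Finset (Fin N)))
    (φ : Fin N → Fin M) (C : Finset (Fin N)) : ℝ :=
  (∑ Ci ∈ P, ((Ci ∩ C).card : ℝ) / (Ci.card : ℝ) * util μ 0 Ci φ) - pess μ 0 C

/-- `B^{--}`. -/
def Bmm (μ : Fin M → ℕ → ℝ) (P : Finset (Finset (Fin N))) (φ : Fin N → Fin M) :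
    Set (Finset (Fin N)) :=
  {C | (C.Nonempty ∧ C ∉ P) ∧ Dcoef P C ≤ 0 ∧ Gam μ P φ C < 0}

/-- `B^{+-}`. -/
def Bpm (μ : Fin M → ℕ → ℝ) (P : Finset (Finset (Fin N))) (φ : Fin N → Fin M) :
    Set (Finset (Fin N)) :=
  {C | (C.Nonempty ∧ C ∉ P) ∧ 0 < Dcoef P C ∧ Gam μ P φ C < 0}

/-- `B^{-+}`. -/
def Bmp (μ : Fin M → ℕ → ℝ) (P : Finset (Finset (Fin N))) (φ : Fin N → Fin M) :
    Set (Finset (Fin N)) :=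
  {C | (C.Nonempty ∧ C ∉ P) ∧ Dcoef P C < 0 ∧ 0 ≤ Gam μ P φ C}

/-- `β̄_u^P(φ) = min_{C ∈ B^{-+}} (−Γ_C^P(φ)/D_C^P)`, with `min ∅ = +∞` (in `EReal`). -/
noncomputable def betaU (μ : Fin M → ℕ → ℝ) (P : Finset (Finset (Fin N)))
    (φ : Fin N → Fin M) : EReal :=
  sInf ((fun C => ((-(Gam μ P φ C) / Dcoef P C : ℝ) : EReal)) '' Bmp μ P φ)

/-- `β̄_d^P(φ) = max_{C ∈ B^{+-}} (−Γ_C^P(φ)/D_C^P)`, with `max ∅ = 0` (in `EReal`). -/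
noncomputable def betaD (μ : Fin M → ℕ → ℝ) (P : Finset (Finset (Fin N)))
    (φ : Fin N → Fin M) : EReal :=
  sSup (insert (0 : EReal)
    ((fun C => ((-(Gam μ P φ C) / Dcoef P C : ℝ) : EReal)) '' Bpm μ P φ))

theorem gamma_comp_perm (σ : Equiv.Perm (Fin N)) (φ : Fin N → Fin M) (a : Fin M) :
    gamma (φ ∘ σ) a = gamma φ a := by
  unfold gamma
  refine Finset.card_bij (fun i _ => σ i) ?_ (fun i _ j _ h => σ.injective h) ?_
  · intro i hi
    simpa using hi
  · intro i hi
    exact ⟨σ.symm i, by simpa using hi, by simp⟩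

theorem util_map_perm (μ : Fin M → ℕ → ℝ) (β : ℝ) (σ : Equiv.Perm (Fin N))
    (C : Finset (Fin N)) (φ : Fin N → Fin M) :
    util μ β (C.map σ.toEmbedding) φ = util μ β C (φ ∘ σ) := by
  simp [util, gamma_comp_perm]

theorem IsPartition.map_perm {P : Finset (Finset (Fin N))} (hP : IsPartition P)
    (σ : Equiv.Perm (Fin N)) : IsPartition (P.image fun C => C.map σ.toEmbedding) := by
  obtain ⟨hne, hdisj, hcov⟩ := hP
  refine ⟨?_, ?_, ?_⟩
  · simp only [Finset.forall_mem_image, Finset.map_nonempty]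
    exact hne
  · simp only [Finset.forall_mem_image]
    intro C hC C' hC' h
    rw [Finset.disjoint_map]
    exact hdisj C hC C' hC' fun e => h (by rw [e])
  · intro i
    obtain ⟨C, hC, hi⟩ := hcov (σ.symm i)
    exact ⟨_, Finset.mem_image_of_mem _ hC, by simpa [Finset.mem_map_equiv] using hi⟩

theorem IsNE.map_perm {μ : Fin M → ℕ → ℝ} {β : ℝ} {P : Finset (Finset (Fin N))}
    {φ : Fin N → Fin M} (hφ : IsNE μ β P φ) (σ : Equiv.Perm (Fin N)) :
    IsNE μ β (P.image fun C => C.map σ.toEmbedding) (φ ∘ σ.symm) := by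
  simp only [IsNE, Finset.forall_mem_image]
  intro C hC φ' h
  have hcomp : (φ ∘ σ.symm) ∘ σ = φ := by
    ext i
    simp
  rw [util_map_perm, util_map_perm, hcomp]
  refine hφ C hC _ fun i hi => ?_
  simpa using h (σ i) (by simpa [Finset.mem_map_equiv] using hi)

/-- The pessimal anticipated worth is anonymous: it is invariant under relabelling players. -/
theorem pess_map_perm (μ : Fin M → ℕ → ℝ) (β : ℝ) (σ : Equiv.Perm (Fin N))
    (C : Finset (Fin N)) : pess μ β (C.map σ.toEmbedding) = pess μ β C := by
  unfold pess
  congr 1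
  ext x
  constructor
  · rintro ⟨P', φ', hP', hC, hφ', rfl⟩
    refine ⟨P'.image fun D => D.map σ.symm.toEmbedding, φ' ∘ σ, hP'.map_perm σ.symm,
      Finset.mem_image.2 ⟨_, hC, ?_⟩, hφ'.map_perm σ.symm, util_map_perm μ β σ C φ'⟩
    ext i
    simp [Finset.mem_map_equiv]
  · rintro ⟨P', φ', hP', hC, hφ', rfl⟩
    refine ⟨P'.image fun D => D.map σ.toEmbedding, φ' ∘ σ.symm, hP'.map_perm σ,
      Finset.mem_image_of_mem _ hC, hφ'.map_perm σ, ?_⟩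
    rw [util_map_perm]
    congr 1
    ext i
    simp

open Classical in
/-- The permutations of the players that preserve every coalition of `P`. -/
noncomputable def blockPerms (P : Finset (Finset (Fin N))) : Finset (Equiv.Perm (Fin N)) :=
  Finset.univ.filter fun σ => ∀ C ∈ P, ∀ i, σ i ∈ C ↔ i ∈ C

theorem mem_blockPerms {P : Finset (Finset (Fin N))} {σ : Equiv.Perm (Fin N)} :
    σ ∈ blockPerms P ↔ ∀ C ∈ P, ∀ i, σ i ∈ C ↔ i ∈ C := by
  simp [blockPerms]

theorem one_mem_blockPerms (P : Finset (Finset (Fin N))) : 1 ∈ blockPerms P :=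
  mem_blockPerms.2 fun _ _ _ => Iff.rfl

theorem IsPartition.swap_mem_iff {P : Finset (Finset (Fin N))} (hP : IsPartition P)
    {B : Finset (Fin N)} (hB : B ∈ P) {j k : Fin N} (hj : j ∈ B) (hk : k ∈ B)
    {C : Finset (Fin N)} (hC : C ∈ P) (i : Fin N) : Equiv.swap j k i ∈ C ↔ i ∈ C := by
  have hjk : j ∈ C ↔ k ∈ C := by
    by_cases h : B = C
    · subst h
      simp [hj, hk]
    · have hd := Finset.disjoint_left.1 (hP.2.1 B hB C hC h)
      simp [hd hj, hd hk]
  by_cases h1 : i = j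
  · subst h1
    simp [hjk]
  by_cases h2 : i = k
  · subst h2
    simp [hjk]
  rw [Equiv.swap_apply_of_ne_of_ne h1 h2]

theorem map_eq_of_mem_blockPerms {P : Finset (Finset (Fin N))} {σ : Equiv.Perm (Fin N)}
    (hσ : σ ∈ blockPerms P) {B : Finset (Fin N)} (hB : B ∈ P) :
    B.map σ.toEmbedding = B := by
  ext i
  rw [Finset.mem_map_equiv]
  simpa using (mem_blockPerms.1 hσ B hB (σ.symm i)).symm

/-- Averaging over the coalition-preserving permutations turns a vector into its fair version. -/
theorem sum_blockPerms_apply {P : Finset (Finset (Fin N))} (hP : IsPartition P)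
    {B : Finset (Fin N)} (hB : B ∈ P) (ψ : Fin N → ℝ) {j : Fin N} (hj : j ∈ B) :
    ∑ σ ∈ blockPerms P, ψ (σ j)
      = (blockPerms P).card * ((∑ k ∈ B, ψ k) / (B.card : ℝ)) := by
  have hconst : ∀ k ∈ B, ∑ σ ∈ blockPerms P, ψ (σ k) = ∑ σ ∈ blockPerms P, ψ (σ j) := by
    intro k hk
    refine Finset.sum_equiv (Equiv.mulRight (Equiv.swap j k)) (fun σ => ?_) (by simp)
    simp only [mem_blockPerms, Equiv.coe_mulRight, Equiv.Perm.mul_apply]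
    refine forall₂_congr fun C hC => ⟨fun h i => ?_, fun h i => ?_⟩
    · rw [h, hP.swap_mem_iff hB hj hk hC]
    · exact (by simpa using h (Equiv.swap j k i) : σ i ∈ C ↔ _).trans
        (hP.swap_mem_iff hB hj hk hC i)
  have htotal : ∑ k ∈ B, ∑ σ ∈ blockPerms P, ψ (σ k)
      = (blockPerms P).card * ∑ k ∈ B, ψ k := by
    rw [Finset.sum_comm, ← nsmul_eq_mul]
    refine Finset.sum_eq_card_nsmul fun σ hσ => ?_
    conv_rhs => rw [← map_eq_of_mem_blockPerms hσ hB]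
    simp
  rw [Finset.sum_congr rfl hconst, Finset.sum_const, nsmul_eq_mul] at htotal
  have hcard : (B.card : ℝ) ≠ 0 := by
    exact_mod_cast (Finset.card_pos.2 (hP.1 B hB)).ne'
  field_simp
  linarith

end CG
open CG in
/-- a P-NE pair `(P, φ)` is stable iff the configuration `(P, φ, ψ_f)`
with the fair payoff vector `ψ_f` is stable. -/
theorem stmt0 {N M : ℕ} (hN : 2 ≤ N) (hMN : N ≤ M)
    (μ : Fin M → ℕ → ℝ)
    (hpos : ∀ a : Fin M, ∀ k : ℕ, 1 ≤ k → k ≤ N → 0 < μ a k)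
    (hmono : ∀ a b : Fin M, a ≤ b → μ b 1 ≤ μ a 1)
    (β : ℝ) (hβ : 0 ≤ β)
    (P : Finset (Finset (Fin N))) (hP : IsPartition P)
    (φ : Fin N → Fin M) (hφ : IsNE μ β P φ)
    (ψf : Fin N → ℝ)
    (hψf : ∀ C ∈ P, ∀ j ∈ C, ψf j = util μ β C φ / (C.card : ℝ)) :
    PairStable μ β P φ ↔ ConfigStable μ β P φ ψf := by
  refine ⟨fun ⟨ψ, _, _, ⟨hnn, hsum⟩, hst⟩ => ⟨hP, hφ, ⟨fun j => ?_, fun C hC => ?_⟩, fun C hC => ?_⟩,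
    fun h => ⟨ψf, h⟩⟩
  · obtain ⟨B, hB, hj⟩ := hP.2.2 j
    rw [hψf B hB j hj, ← hsum B hB]
    exact div_nonneg (Finset.sum_nonneg fun k _ => hnn k) (Nat.cast_nonneg _)
  · have hcard : (C.card : ℝ) ≠ 0 := by
      exact_mod_cast (Finset.card_pos.2 (hP.1 C hC)).ne'
    rw [Finset.sum_congr rfl (hψf C hC), Finset.sum_const, nsmul_eq_mul]
    field_simp
  · obtain ⟨hne, hCP, hlt⟩ := hC
    have havg : ∑ σ ∈ blockPerms P, ∑ j ∈ C, ψ (σ j)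
        = ∑ σ ∈ blockPerms P, ∑ j ∈ C, ψf j := by
      rw [Finset.sum_comm, Finset.sum_const, nsmul_eq_mul, Finset.mul_sum]
      refine Finset.sum_congr rfl fun j _ => ?_
      obtain ⟨B, hB, hj⟩ := hP.2.2 j
      rw [sum_blockPerms_apply hP hB ψ hj, hψf B hB j hj, hsum B hB]
    obtain ⟨σ, hσ, hle⟩ := Finset.exists_le_of_sum_le ⟨1, one_mem_blockPerms P⟩ havg.le
    refine hst (C.map σ.toEmbedding) ⟨hne.map, fun hmem => hCP ?_, ?_⟩
    · have heq := map_eq_of_mem_blockPerms hσ hmem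
      rwa [Finset.map_inj.1 heq] at hmem
    · rw [pess_map_perm, Finset.sum_map]
      exact hle.trans_lt hlt
end

section
/- Let P = {C₁,…,C_n} be a partition, φ ∈ Φ^P a Nash equilibrium for P, and β ≥ 0. Then the P-NE pair (P,φ) is stable at cost β if and only if for every coalition C ∉ P: Γ_C^P(φ) + D_C^P · β ≥ 0. -/
open Finset

namespace CG

variable {N M : ℕ}

/-- The set of worths that a coalition `C` can obtain at some equilibrium of some partition
having `C` as a block; `pess` is its infimum. -/
def eqWorths (μ : Fin M → ℕ → ℝ) (β : ℝ) (C : Finset (Fin N)) : Set ℝ :=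
  {x : ℝ | ∃ P' : Finset (Finset (Fin N)), ∃ φ' : Fin N → Fin M,
    IsPartition P' ∧ C ∈ P' ∧ IsNE μ β P' φ' ∧ x = util μ β C φ'}

theorem pess_eq_sInf (μ : Fin M → ℕ → ℝ) (β : ℝ) (C : Finset (Fin N)) :
    pess μ β C = sInf (eqWorths μ β C) := rfl

theorem util_eq_util_zero_sub (μ : Fin M → ℕ → ℝ) (β : ℝ) (C : Finset (Fin N))
    (φ : Fin N → Fin M) : util μ β C φ = util μ 0 C φ - ((C.card : ℝ) - 1) * β := by
  simp [util]

theorem isNE_iff_isNE_zero (μ : Fin M → ℕ → ℝ) (β : ℝ) (P : Finset (Finset (Fin N)))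
    (φ : Fin N → Fin M) : IsNE μ β P φ ↔ IsNE μ 0 P φ := by
  simp [IsNE, util]

theorem util_zero_nonneg {μ : Fin M → ℕ → ℝ}
    (hpos : ∀ a : Fin M, ∀ k : ℕ, 1 ≤ k → k ≤ N → 0 < μ a k) (C : Finset (Fin N))
    (φ : Fin N → Fin M) : 0 ≤ util μ 0 C φ := by
  simp only [util, mul_zero, sub_zero]
  refine Finset.sum_nonneg fun i _ => (hpos _ _ ?_ ?_).le
  · exact Finset.card_pos.2 ⟨i, by simp⟩
  · exact (Finset.card_le_univ _).trans (by simp)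

theorem eqWorths_zero_nonneg {μ : Fin M → ℕ → ℝ}
    (hpos : ∀ a : Fin M, ∀ k : ℕ, 1 ≤ k → k ≤ N → 0 < μ a k) {C : Finset (Fin N)} {x : ℝ}
    (hx : x ∈ eqWorths μ 0 C) : 0 ≤ x := by
  obtain ⟨_, φ', _, _, _, rfl⟩ := hx
  exact util_zero_nonneg hpos C φ'

theorem eqWorths_eq_image (μ : Fin M → ℕ → ℝ) (β : ℝ) (C : Finset (Fin N)) :
    eqWorths μ β C = OrderIso.subRight (((C.card : ℝ) - 1) * β) '' eqWorths μ 0 C := by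
  ext x
  simp only [eqWorths, Set.mem_image, Set.mem_ofPred_eq, OrderIso.subRight_apply]
  constructor
  · rintro ⟨P', φ', h1, h2, h3, rfl⟩
    exact ⟨_, ⟨P', φ', h1, h2, (isNE_iff_isNE_zero μ β P' φ').1 h3, rfl⟩,
      (util_eq_util_zero_sub μ β C φ').symm⟩
  · rintro ⟨_, ⟨P', φ', h1, h2, h3, rfl⟩, rfl⟩
    exact ⟨P', φ', h1, h2, (isNE_iff_isNE_zero μ β P' φ').2 h3,
      (util_eq_util_zero_sub μ β C φ').symm⟩

theorem pess_eq_pess_zero_sub {μ : Fin M → ℕ → ℝ}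
    (hpos : ∀ a : Fin M, ∀ k : ℕ, 1 ≤ k → k ≤ N → 0 < μ a k) (β : ℝ) {C : Finset (Fin N)}
    (hne : (eqWorths μ 0 C).Nonempty) :
    pess μ β C = pess μ 0 C - ((C.card : ℝ) - 1) * β := by
  rw [pess_eq_sInf, pess_eq_sInf, eqWorths_eq_image, ← OrderIso.map_csInf' _ hne
    ⟨0, fun _ hx => eqWorths_zero_nonneg hpos hx⟩, OrderIso.subRight_apply]

theorem pess_eq_zero_of_eqWorths_eq_empty {μ : Fin M → ℕ → ℝ} (β : ℝ) {C : Finset (Fin N)}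
    (hempty : eqWorths μ 0 C = ∅) : pess μ β C = 0 := by
  rw [pess_eq_sInf, eqWorths_eq_image, hempty, Set.image_empty, Real.sInf_empty]

theorem pess_zero_nonneg {μ : Fin M → ℕ → ℝ}
    (hpos : ∀ a : Fin M, ∀ k : ℕ, 1 ≤ k → k ≤ N → 0 < μ a k) (C : Finset (Fin N)) :
    0 ≤ pess μ 0 C :=
  Real.sInf_nonneg fun _ hx => eqWorths_zero_nonneg hpos hx

/-! ### Symmetry under relabelling the players -/

theorem gamma_comp_symm (σ : Equiv.Perm (Fin N)) (φ : Fin N → Fin M) (a : Fin M) :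
    gamma (φ ∘ σ.symm) a = gamma φ a := by
  unfold gamma
  refine Finset.card_equiv σ.symm fun i => ?_
  simp

theorem util_map (σ : Equiv.Perm (Fin N)) (μ : Fin M → ℕ → ℝ) (β : ℝ) (C : Finset (Fin N))
    (φ : Fin N → Fin M) :
    util μ β (C.map σ.toEmbedding) (φ ∘ σ.symm) = util μ β C φ := by
  simp [util, gamma_comp_symm]

theorem IsPartition.image_map {P : Finset (Finset (Fin N))} (hP : IsPartition P)
    (σ : Equiv.Perm (Fin N)) : IsPartition (P.image fun D => D.map σ.toEmbedding) := by
  refine ⟨?_, ?_, fun i => ?_⟩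
  · simpa using hP.1
  · simp only [Finset.forall_mem_image]
    intro D hD E hE hne
    exact (Finset.disjoint_map _).2 (hP.2.1 D hD E hE fun h => hne (h ▸ rfl))
  · obtain ⟨D, hD, hi⟩ := hP.2.2 (σ.symm i)
    exact ⟨_, Finset.mem_image_of_mem _ hD, by simpa using hi⟩

theorem IsNE.image_map {μ : Fin M → ℕ → ℝ} {β : ℝ} {P : Finset (Finset (Fin N))}
    {φ : Fin N → Fin M} (h : IsNE μ β P φ) (σ : Equiv.Perm (Fin N)) :
    IsNE μ β (P.image fun D => D.map σ.toEmbedding) (φ ∘ σ.symm) := by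
  intro C hC φ' hφ'
  obtain ⟨D, hD, rfl⟩ := Finset.mem_image.1 hC
  have hcomp : φ' = (φ' ∘ σ) ∘ σ.symm := by ext i; simp
  rw [hcomp, util_map, util_map]
  refine h D hD _ fun i hi => ?_
  simpa using hφ' (σ i) (by simpa using hi)

theorem eqWorths_subset_map (σ : Equiv.Perm (Fin N)) (μ : Fin M → ℕ → ℝ) (β : ℝ)
    (C : Finset (Fin N)) : eqWorths μ β C ⊆ eqWorths μ β (C.map σ.toEmbedding) := by
  rintro _ ⟨P', φ', h1, h2, h3, rfl⟩
  exact ⟨_, φ' ∘ σ.symm, h1.image_map σ, Finset.mem_image_of_mem _ h2, h3.image_map σ,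
    (util_map σ μ β C φ').symm⟩

theorem exists_perm_map_eq {C C' : Finset (Fin N)} (h : C.card = C'.card) :
    ∃ σ : Equiv.Perm (Fin N), C.map σ.toEmbedding = C' := by
  let e : {x // x ∈ C} ≃ {x // x ∈ C'} := Finset.equivOfCardEq h
  refine ⟨e.extendSubtype, Finset.eq_of_subset_of_card_le ?_ (by simp [h])⟩
  intro x hx
  obtain ⟨y, hy, rfl⟩ := Finset.mem_map.1 hx
  exact e.extendSubtype_mem y hy

theorem eqWorths_subset_of_card_eq (μ : Fin M → ℕ → ℝ) (β : ℝ) {C C' : Finset (Fin N)}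
    (h : C.card = C'.card) : eqWorths μ β C ⊆ eqWorths μ β C' := by
  obtain ⟨σ, rfl⟩ := exists_perm_map_eq h
  exact eqWorths_subset_map σ μ β C

/-- The pessimal anticipated worth of a coalition depends only on its size. -/
theorem pess_eq_of_card_eq (μ : Fin M → ℕ → ℝ) (β : ℝ) {C C' : Finset (Fin N)}
    (h : C.card = C'.card) : pess μ β C = pess μ β C' := by
  rw [pess_eq_sInf, pess_eq_sInf, (eqWorths_subset_of_card_eq μ β h).antisymm
    (eqWorths_subset_of_card_eq μ β h.symm)]

/-! ### Averaging inside the blocks of a partition -/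

/-- Every finite set has a subset of any prescribed smaller size on which the average of `ψ` is
at most its average on the whole set. -/
theorem exists_subset_card_eq_sum_mul_le {ι : Type*} [DecidableEq ι] (ψ : ι → ℝ)
    (S : Finset ι) {q : ℕ} (hq : q ≤ S.card) :
    ∃ T ⊆ S, T.card = q ∧ (∑ j ∈ T, ψ j) * S.card ≤ q * ∑ j ∈ S, ψ j := by
  induction S using Finset.induction_on_max_value ψ generalizing q with
  | empty =>
    have : q = 0 := by simpa using hq
    exact ⟨∅, by simp, by simp [this], by simp⟩
  | insert a s ha hmax ih =>
    rw [Finset.card_insert_of_notMem ha] at hq ⊢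
    rcases hq.eq_or_lt with rfl | hlt
    · refine ⟨insert a s, subset_rfl, Finset.card_insert_of_notMem ha, ?_⟩
      exact (mul_comm _ _).le
    · obtain ⟨T, hTs, hTq, hT⟩ := ih (Nat.lt_succ_iff.1 hlt)
      refine ⟨T, hTs.trans (Finset.subset_insert _ _), hTq, ?_⟩
      have hle : ∑ j ∈ T, ψ j ≤ q * ψ a := by
        simpa [hTq] using Finset.sum_le_card_nsmul T ψ (ψ a) fun j hj => hmax j (hTs hj)
      rw [Finset.sum_insert ha]
      push_cast
      linarith

theorem IsPartition.biUnion_inter {P : Finset (Finset (Fin N))} (hP : IsPartition P)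
    (C : Finset (Fin N)) : (P.biUnion fun D => D ∩ C) = C := by
  ext i
  obtain ⟨D, hD, hi⟩ := hP.2.2 i
  simp only [Finset.mem_biUnion, Finset.mem_inter]
  exact ⟨fun ⟨_, _, _, h⟩ => h, fun h => ⟨D, hD, hi, h⟩⟩

theorem IsPartition.pairwiseDisjoint {P : Finset (Finset (Fin N))} (hP : IsPartition P)
    {T : Finset (Fin N) → Finset (Fin N)} (hT : ∀ D ∈ P, T D ⊆ D) :
    (P : Set (Finset (Fin N))).PairwiseDisjoint T :=
  fun D hD E hE hne => (hP.2.1 D hD E hE hne).mono (hT D hD) (hT E hE)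

theorem IsPartition.sum_card_inter {P : Finset (Finset (Fin N))} (hP : IsPartition P)
    (C : Finset (Fin N)) : ∑ D ∈ P, (D ∩ C).card = C.card := by
  rw [← Finset.card_biUnion (hP.pairwiseDisjoint fun _ _ => Finset.inter_subset_left),
    hP.biUnion_inter]

theorem eq_of_card_inter_eq {C D : Finset (Fin N)} (hDC : (D ∩ C).card = D.card)
    (hcard : C.card = D.card) : D = C := by
  have hsub : D ⊆ C :=
    Finset.inter_eq_left.1 (Finset.eq_of_subset_of_card_le Finset.inter_subset_left hDC.ge)
  exact Finset.eq_of_subset_of_card_le hsub hcard.le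

/-- Among the coalitions meeting each block in the same number of players as `C`, one has total
payoff at most the average. -/
theorem IsPartition.exists_card_eq_sum_le {P : Finset (Finset (Fin N))} (hP : IsPartition P)
    {C : Finset (Fin N)} (hCP : C ∉ P) (ψ : Fin N → ℝ) :
    ∃ C' ∉ P, C'.card = C.card ∧
      ∑ j ∈ C', ψ j ≤ ∑ D ∈ P, ((D ∩ C).card : ℝ) / (D.card : ℝ) * ∑ j ∈ D, ψ j := by
  choose T hTD hTq hT using fun D : Finset (Fin N) =>
    exists_subset_card_eq_sum_mul_le ψ D (Finset.card_le_card (Finset.inter_subset_left (s₂ := C)))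
  have hdisj := hP.pairwiseDisjoint fun D _ => hTD D
  have hcard : (P.biUnion T).card = C.card := by
    rw [Finset.card_biUnion hdisj, ← hP.sum_card_inter C]
    exact Finset.sum_congr rfl fun D _ => hTq D
  refine ⟨P.biUnion T, fun hmem => hCP ?_, hcard, ?_⟩
  · refine eq_of_card_inter_eq ?_ hcard.symm ▸ hmem
    have hsub : P.biUnion T ⊆ T (P.biUnion T) := by
      intro i hi
      obtain ⟨E, hE, hiE⟩ := Finset.mem_biUnion.1 hi
      by_cases h : P.biUnion T = E
      · rwa [h]
      · exact absurd (hTD E hiE) (Finset.disjoint_left.1 (hP.2.1 _ hmem E hE h) hi)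
    rw [← hTq, (hTD _).antisymm hsub]
  · rw [Finset.sum_biUnion hdisj]
    refine Finset.sum_le_sum fun D hD => ?_
    have hpos : (0 : ℝ) < D.card := by exact_mod_cast Finset.card_pos.2 (hP.1 D hD)
    rw [div_mul_eq_mul_div, le_div_iff₀ hpos]
    exact hT D

theorem IsPartition.sum_ratio_mul_util {P : Finset (Finset (Fin N))} (hP : IsPartition P)
    (μ : Fin M → ℕ → ℝ) (β : ℝ) (φ : Fin N → Fin M) (C : Finset (Fin N)) :
    ∑ D ∈ P, ((D ∩ C).card : ℝ) / (D.card : ℝ) * util μ β D φ =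
      Gam μ P φ C + Dcoef P C * β + (pess μ 0 C - ((C.card : ℝ) - 1) * β) := by
  have hterm : ∀ D ∈ P, ((D ∩ C).card : ℝ) / (D.card : ℝ) * util μ β D φ =
      ((D ∩ C).card : ℝ) / (D.card : ℝ) * util μ 0 D φ - ((D ∩ C).card : ℝ) * β
        + ((D ∩ C).card : ℝ) / (D.card : ℝ) * β := by
    intro D hD
    have hne : (D.card : ℝ) ≠ 0 := by exact_mod_cast (Finset.card_pos.2 (hP.1 D hD)).ne'
    rw [util_eq_util_zero_sub]
    field_simp
    ring
  have hsum : ∑ D ∈ P, ((D ∩ C).card : ℝ) = C.card := by exact_mod_cast hP.sum_card_inter C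
  rw [Finset.sum_congr rfl hterm, Finset.sum_add_distrib, Finset.sum_sub_distrib,
    ← Finset.sum_mul, ← Finset.sum_mul, hsum, Gam, Dcoef]
  ring

theorem IsPartition.sum_ratio_mul_of_mem {P : Finset (Finset (Fin N))} (hP : IsPartition P)
    {C B : Finset (Fin N)} (hB : B ∈ P) (hCB : C ⊆ B) (f : Finset (Fin N) → ℝ) :
    ∑ D ∈ P, ((D ∩ C).card : ℝ) / (D.card : ℝ) * f D = (C.card : ℝ) / (B.card : ℝ) * f B := by
  rw [Finset.sum_eq_single_of_mem B hB, Finset.inter_eq_right.2 hCB]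
  intro D hD hne
  rw [Finset.disjoint_iff_inter_eq_empty.1 ((hP.2.1 D hD B hB hne).mono_right hCB)]
  simp

/-- The payoff vector in which every coalition of `P` shares its worth equally. -/
noncomputable def equalSplit (μ : Fin M → ℕ → ℝ) (β : ℝ) (P : Finset (Finset (Fin N)))
    (φ : Fin N → Fin M) (j : Fin N) : ℝ :=
  ∑ D ∈ P, if j ∈ D then util μ β D φ / (D.card : ℝ) else 0

theorem sum_equalSplit (μ : Fin M → ℕ → ℝ) (β : ℝ) (P : Finset (Finset (Fin N)))
    (φ : Fin N → Fin M) (C : Finset (Fin N)) :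
    ∑ j ∈ C, equalSplit μ β P φ j =
      ∑ D ∈ P, ((D ∩ C).card : ℝ) / (D.card : ℝ) * util μ β D φ := by
  unfold equalSplit
  rw [Finset.sum_comm]
  refine Finset.sum_congr rfl fun D _ => ?_
  rw [← Finset.sum_filter, Finset.filter_mem_eq_inter, Finset.inter_comm, Finset.sum_const,
    nsmul_eq_mul]
  ring

theorem IsPartition.consistent_equalSplit {P : Finset (Finset (Fin N))} (hP : IsPartition P)
    {μ : Fin M → ℕ → ℝ} {β : ℝ} {φ : Fin N → Fin M} (h : ∀ D ∈ P, 0 ≤ util μ β D φ) :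
    Consistent μ β P φ (equalSplit μ β P φ) := by
  refine ⟨fun j => Finset.sum_nonneg fun D hD => ?_, fun C hC => ?_⟩
  · split_ifs
    · exact div_nonneg (h D hD) (Nat.cast_nonneg _)
    · exact le_rfl
  · have hne : (C.card : ℝ) ≠ 0 := by exact_mod_cast (Finset.card_pos.2 (hP.1 C hC)).ne'
    rw [sum_equalSplit, hP.sum_ratio_mul_of_mem hC subset_rfl fun D => util μ β D φ,
      div_self hne, one_mul]

/-- The singleton conditions of the stability criterion make the worths of all blocks
nonnegative. -/
theorem IsPartition.util_nonneg {P : Finset (Finset (Fin N))} (hP : IsPartition P)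
    {μ : Fin M → ℕ → ℝ} (hpos : ∀ a : Fin M, ∀ k : ℕ, 1 ≤ k → k ≤ N → 0 < μ a k)
    {β : ℝ} {φ : Fin N → Fin M}
    (h : ∀ C : Finset (Fin N), C.Nonempty → C ∉ P → 0 ≤ Gam μ P φ C + Dcoef P C * β)
    {D : Finset (Fin N)} (hD : D ∈ P) : 0 ≤ util μ β D φ := by
  obtain ⟨j, hj⟩ := hP.1 D hD
  have hjD : {j} ⊆ D := Finset.singleton_subset_iff.2 hj
  by_cases hmem : {j} ∈ P
  · have hDj : D = {j} := by
      by_contra hne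
      exact Finset.disjoint_left.1 (hP.2.1 D hD _ hmem hne) hj (Finset.mem_singleton_self j)
    rw [util_eq_util_zero_sub, hDj]
    simpa using util_zero_nonneg hpos {j} φ
  · have hid := hP.sum_ratio_mul_util μ β φ {j}
    rw [hP.sum_ratio_mul_of_mem hD hjD fun D => util μ β D φ] at hid
    have hge := h {j} (Finset.singleton_nonempty j) hmem
    have hpess := pess_zero_nonneg hpos (N := N) {j}
    have hcard : (0 : ℝ) < D.card := by exact_mod_cast Finset.card_pos.2 ⟨j, hj⟩
    simp only [Finset.card_singleton, Nat.cast_one, sub_self, zero_mul, sub_zero] at hid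
    have hprod : 0 ≤ 1 / (D.card : ℝ) * util μ β D φ := by linarith
    exact nonneg_of_mul_nonneg_right hprod (by positivity)

end CG

open CG in
/-- the P-NE pair `(P, φ)` is stable at cost `β` iff
`Γ_C^P(φ) + D_C^P · β ≥ 0` for every coalition `C ∉ P`. -/
theorem stmt3 {N M : ℕ} (hN : 2 ≤ N) (hMN : N ≤ M)
    (μ : Fin M → ℕ → ℝ)
    (hpos : ∀ a : Fin M, ∀ k : ℕ, 1 ≤ k → k ≤ N → 0 < μ a k)
    (hmono : ∀ a b : Fin M, a ≤ b → μ b 1 ≤ μ a 1)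
    (P : Finset (Finset (Fin N))) (hP : IsPartition P)
    (φ : Fin N → Fin M) (hφ : IsNE μ 0 P φ)
    (β : ℝ) (hβ : 0 ≤ β) :
    PairStable μ β P φ ↔
      ∀ C : Finset (Fin N), C.Nonempty → C ∉ P →
        0 ≤ Gam μ P φ C + Dcoef P C * β := by
  constructor
  · rintro ⟨ψ, -, -, ⟨hψ, hcons⟩, hstab⟩ C hC hCP
    have hid := hP.sum_ratio_mul_util μ β φ C
    have hcard : (1 : ℝ) ≤ C.card := by exact_mod_cast Finset.card_pos.2 hC
    rcases (eqWorths μ 0 C).eq_empty_or_nonempty with hempty | hne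
    · rw [pess_eq_zero_of_eqWorths_eq_empty 0 hempty] at hid
      have hnonneg : 0 ≤ ∑ D ∈ P, ((D ∩ C).card : ℝ) / (D.card : ℝ) * util μ β D φ :=
        Finset.sum_nonneg fun D hD => mul_nonneg (by positivity)
          (hcons D hD ▸ Finset.sum_nonneg fun j _ => hψ j)
      have : 0 ≤ ((C.card : ℝ) - 1) * β := mul_nonneg (by linarith) hβ
      linarith
    · obtain ⟨C', hC'P, hC'card, hC'le⟩ := hP.exists_card_eq_sum_le hCP ψ
      have hC' : C'.Nonempty := Finset.card_pos.1 (hC'card ▸ Finset.card_pos.2 hC)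
      have hge : pess μ β C' ≤ ∑ j ∈ C', ψ j :=
        not_lt.1 fun hlt => hstab C' ⟨hC', hC'P, hlt⟩
      rw [pess_eq_of_card_eq μ β hC'card, pess_eq_pess_zero_sub hpos β hne] at hge
      have hsum : ∑ D ∈ P, ((D ∩ C).card : ℝ) / (D.card : ℝ) * ∑ j ∈ D, ψ j =
          ∑ D ∈ P, ((D ∩ C).card : ℝ) / (D.card : ℝ) * util μ β D φ :=
        Finset.sum_congr rfl fun D hD => by rw [hcons D hD]
      linarith
  · intro h
    have hutil : ∀ D ∈ P, 0 ≤ util μ β D φ := fun D hD => hP.util_nonneg hpos h hD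
    have hcons := hP.consistent_equalSplit hutil
    refine ⟨equalSplit μ β P φ, hP, (isNE_iff_isNE_zero μ β P φ).2 hφ, hcons, ?_⟩
    rintro C ⟨hC, hCP, hlt⟩
    rcases (eqWorths μ 0 C).eq_empty_or_nonempty with hempty | hne
    · rw [pess_eq_zero_of_eqWorths_eq_empty β hempty] at hlt
      exact hlt.not_ge (Finset.sum_nonneg fun j _ => hcons.1 j)
    · rw [sum_equalSplit, hP.sum_ratio_mul_util, pess_eq_pess_zero_sub hpos β hne] at hlt
      linarith [h C hC hCP]
end

section
/- Let (P,φ) be a P-NE pair with B^{--} = ∅ and with P not equal to the ALC partition P_A (the partition into singletons). Then β̄_u^P(φ) < ∞; equivalently, the set B^{-+} is nonempty. -/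
open Finset

open CG in
/-- if `B^{--} = ∅` and `P` is not the ALC partition, then
`B^{-+} ≠ ∅`, equivalently `β̄_u^P(φ) < ∞`. -/
theorem stmt6 {N M : ℕ} (hN : 2 ≤ N) (hMN : N ≤ M)
    (μ : Fin M → ℕ → ℝ)
    (hpos : ∀ a : Fin M, ∀ k : ℕ, 1 ≤ k → k ≤ N → 0 < μ a k)
    (hmono : ∀ a b : Fin M, a ≤ b → μ b 1 ≤ μ a 1)
    (P : Finset (Finset (Fin N))) (hP : IsPartition P)
    (φ : Fin N → Fin M) (hφ : IsNE μ 0 P φ)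
    (hBmm : Bmm μ P φ = ∅)
    (hPA : P ≠ ALC N) :
    (Bmp μ P φ).Nonempty ∧ betaU μ P φ < ⊤ := by
  obtain ⟨hne, hdis, hcov⟩ := hP
  obtain ⟨A, hA, hcard⟩ : ∃ A ∈ P, 2 ≤ A.card := by
    by_contra! h
    apply hPA
    have hone : ∀ C ∈ P, ∃ i, C = {i} := fun C hC =>
      Finset.card_eq_one.mp (by
        have := h C hC
        have := (hne C hC).card_pos
        omega)
    ext C
    simp only [ALC, Finset.mem_image, Finset.mem_univ, true_and]
    constructor
    · intro hC
      obtain ⟨i, rfl⟩ := hone C hC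
      exact ⟨i, rfl⟩
    · rintro ⟨i, rfl⟩
      obtain ⟨C, hC, hi⟩ := hcov i
      obtain ⟨j, rfl⟩ := hone C hC
      rwa [Finset.mem_singleton.mp hi]
  obtain ⟨j, hj⟩ := hne A hA
  have hjP : ({j} : Finset (Fin N)) ∉ P := by
    intro h
    have hEq : A = {j} := by
      by_contra hAj
      exact Finset.disjoint_left.mp (hdis A hA {j} h hAj) hj (Finset.mem_singleton_self j)
    rw [hEq, Finset.card_singleton] at hcard
    omega
  have hD : Dcoef P {j} < 0 := by
    have hsum : ∑ Ci ∈ P, ((Ci ∩ {j}).card : ℝ) / (Ci.card : ℝ) = 1 / (A.card : ℝ) := by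
      rw [Finset.sum_eq_single_of_mem A hA, Finset.inter_singleton_of_mem hj,
        Finset.card_singleton, Nat.cast_one]
      intro C hC hCA
      rw [Finset.inter_singleton_of_notMem
        (Finset.disjoint_right.mp (hdis C hC A hA hCA) hj)]
      simp
    have h2 : (1 : ℝ) < A.card := by exact_mod_cast hcard
    rw [Dcoef, hsum, sub_neg, div_lt_one (by linarith)]
    exact h2
  have hG : 0 ≤ Gam μ P φ {j} := by
    by_contra! h
    have hmem : {j} ∈ Bmm μ P φ := ⟨⟨Finset.singleton_nonempty j, hjP⟩, hD.le, h⟩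
    rw [hBmm] at hmem
    exact hmem
  have hmem : {j} ∈ Bmp μ P φ := ⟨⟨Finset.singleton_nonempty j, hjP⟩, hD, hG⟩
  exact ⟨⟨_, hmem⟩, (sInf_le (Set.mem_image_of_mem _ hmem)).trans_lt (EReal.coe_lt_top _)⟩
end

section
/- Assume Φ^{P_A} ≠ ∅, where P_A is the ALC partition into singleton coalitions. Then there exists a threshold β̄^{P_A} ≥ 0 such that P_A is stable at cost β for all β ≥ β̄^{P_A}. -/
open Finset

namespace CG

variable {N M : ℕ}

theorem util_singleton (μ : Fin M → ℕ → ℝ) (β : ℝ) (i : Fin N) (φ : Fin N → Fin M) :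
    util μ β {i} φ = μ (φ i) (gamma φ (φ i)) := by
  simp [util]

theorem isPartition_ALC : IsPartition (ALC N) := by
  refine ⟨?_, ?_, ?_⟩
  · intro C hC
    obtain ⟨i, -, rfl⟩ := Finset.mem_image.1 hC
    exact Finset.singleton_nonempty i
  · intro C hC C' hC' hne
    obtain ⟨i, -, rfl⟩ := Finset.mem_image.1 hC
    obtain ⟨j, -, rfl⟩ := Finset.mem_image.1 hC'
    exact Finset.disjoint_singleton.2 fun h => hne (by rw [h])
  · exact fun i => ⟨{i}, Finset.mem_image_of_mem _ (Finset.mem_univ i),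
      Finset.mem_singleton_self i⟩

/-- Equilibria of the ALC partition do not depend on the communication cost. -/
theorem IsNE.ALC_of_cost {μ : Fin M → ℕ → ℝ} {β : ℝ} {φ : Fin N → Fin M}
    (h : IsNE μ β (ALC N) φ) (β' : ℝ) : IsNE μ β' (ALC N) φ := by
  intro C hC φ' hφ'
  have key := h C hC φ' hφ'
  obtain ⟨i, -, rfl⟩ := Finset.mem_image.1 hC
  simpa only [util_singleton] using key

theorem two_le_card_of_notMem_ALC {C : Finset (Fin N)} (hne : C.Nonempty)
    (hC : C ∉ ALC N) : 2 ≤ C.card := by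
  by_contra! hlt
  have hpos := hne.card_pos
  obtain ⟨i, rfl⟩ := Finset.card_eq_one.1 (show C.card = 1 by omega)
  exact hC (Finset.mem_image_of_mem _ (Finset.mem_univ i))

theorem gamma_apply_pos (φ : Fin N → Fin M) (i : Fin N) : 1 ≤ gamma φ (φ i) :=
  Finset.card_pos.2 ⟨i, by simp⟩

theorem gamma_le (φ : Fin N → Fin M) (a : Fin M) : gamma φ a ≤ N :=
  (Finset.card_le_univ _).trans_eq (Fintype.card_fin N)

/-- An upper bound for the cost-free utility of every coalition under every profile. -/
noncomputable def utilBound (N : ℕ) (μ : Fin M → ℕ → ℝ) : ℝ :=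
  ∑ φ : Fin N → Fin M, ∑ i, |μ (φ i) (gamma φ (φ i))|

theorem utilBound_nonneg (μ : Fin M → ℕ → ℝ) : 0 ≤ utilBound N μ :=
  Finset.sum_nonneg fun _ _ => Finset.sum_nonneg fun _ _ => abs_nonneg _

theorem sum_le_utilBound (μ : Fin M → ℕ → ℝ) (C : Finset (Fin N)) (φ : Fin N → Fin M) :
    ∑ i ∈ C, μ (φ i) (gamma φ (φ i)) ≤ utilBound N μ :=
  calc ∑ i ∈ C, μ (φ i) (gamma φ (φ i))
      ≤ ∑ i ∈ C, |μ (φ i) (gamma φ (φ i))| := Finset.sum_le_sum fun _ _ => le_abs_self _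
    _ ≤ ∑ i, |μ (φ i) (gamma φ (φ i))| :=
        Finset.sum_le_sum_of_subset_of_nonneg (Finset.subset_univ C) fun _ _ _ => abs_nonneg _
    _ ≤ utilBound N μ :=
        Finset.single_le_sum
          (f := fun φ : Fin N → Fin M => ∑ i, |μ (φ i) (gamma φ (φ i))|)
          (fun _ _ => Finset.sum_nonneg fun _ _ => abs_nonneg _) (Finset.mem_univ φ)

theorem pess_nonpos {μ : Fin M → ℕ → ℝ} {β : ℝ} (hβ : utilBound N μ ≤ β)
    {C : Finset (Fin N)} (hC : 2 ≤ C.card) : pess μ β C ≤ 0 := by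
  refine Real.sInf_nonpos ?_
  rintro x ⟨P', φ', -, -, -, rfl⟩
  have hcard : (2 : ℝ) ≤ C.card := by exact_mod_cast hC
  have hsum := sum_le_utilBound μ C φ'
  have hβ0 := (utilBound_nonneg μ).trans hβ
  unfold util
  nlinarith [mul_nonneg (sub_nonneg.2 hcard) hβ0]

end CG

open CG in
/-- if the ALC partition admits a Nash equilibrium, then there is a
threshold `β̄ ≥ 0` such that the ALC partition is stable at every cost `β ≥ β̄`. -/
theorem stmt9 {N M : ℕ} (hN : 2 ≤ N) (hMN : N ≤ M)
    (μ : Fin M → ℕ → ℝ)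
    (hpos : ∀ a : Fin M, ∀ k : ℕ, 1 ≤ k → k ≤ N → 0 < μ a k)
    (hmono : ∀ a b : Fin M, a ≤ b → μ b 1 ≤ μ a 1)
    (hNE : ∃ φ : Fin N → Fin M, IsNE μ 0 (ALC N) φ) :
    ∃ B : ℝ, 0 ≤ B ∧ ∀ β : ℝ, B ≤ β → PartStable μ β (ALC N) := by
  obtain ⟨φ, hφ⟩ := hNE
  refine ⟨utilBound N μ, utilBound_nonneg μ, fun β hβ => ⟨φ,
    fun i => μ (φ i) (gamma φ (φ i)), isPartition_ALC, hφ.ALC_of_cost β, ?_, ?_⟩⟩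
  · refine ⟨fun i => (hpos _ _ (gamma_apply_pos φ i) (gamma_le φ _)).le, fun C hC => ?_⟩
    obtain ⟨i, -, rfl⟩ := Finset.mem_image.1 hC
    rw [util_singleton, Finset.sum_singleton]
  · rintro C ⟨hne, hC, hlt⟩
    exact (hlt.trans_le (pess_nonpos hβ (two_le_card_of_notMem_ALC hne hC))).not_ge
      (Finset.sum_nonneg fun i _ => (hpos _ _ (gamma_apply_pos φ i) (gamma_le φ _)).le)
end
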